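/- Let V be a real vector space with finrank V = 2n (n ≥ 1), ω a nondegenerate alternating bilinear form on V and Y ≤ V a hyperplane. If K ≤ Y is a subspace with finrank K = n − 1 which is ω-isotropic (ω u v = 0 for all u, v ∈ K) and satisfies K ⊓ Y^⊥ = ⊥, then there exists a Lagrangian subspace L ≤ V with L ⊓ Y = K and L ⊔ Y = ⊤. (Every linear slice satisfying the paper's two conditions arises as the transverse intersection of a Lagrangian with the hyperplane.) -/

import Mathlib

/-- The `ω`-orthogonal of a subspace `W`: all `v` with `ω v w = 0` for every `w ∈ W`. -/
def orth {V : Type*} [AddCommGroup V] [Module ℝ V]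
    (ω : V →ₗ[ℝ] V →ₗ[ℝ] ℝ) (W : Submodule ℝ V) : Submodule ℝ V where
  carrier := {v | ∀ w ∈ W, ω v w = 0}
  zero_mem' := by intro w hw; simp
  add_mem' := by intro a b ha hb w hw; simp [ha w hw, hb w hw]
  smul_mem' := by intro c a ha w hw; simp [ha w hw]

theorem orth_eq_orthogonal {V : Type*} [AddCommGroup V] [Module ℝ V]
    {ω : LinearMap.BilinForm ℝ V} (hω : ω.IsRefl) (W : Submodule ℝ V) :
    orth ω W = ω.orthogonal W := by
  ext v
  exact forall₂_congr fun w _ => ⟨fun h => hω v w h, fun h => hω w v h⟩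

/-- Every `(n−1)`-dimensional isotropic subspace `K` of a hyperplane `Y`
avoiding the characteristic line `Y^⊥` is the transverse intersection of some Lagrangian
`L` with `Y`. -/
theorem stmt4 {V : Type*} [AddCommGroup V] [Module ℝ V] [FiniteDimensional ℝ V]
    (n : ℕ) (hn : 1 ≤ n) (hV : Module.finrank ℝ V = 2 * n)
    (ω : V →ₗ[ℝ] V →ₗ[ℝ] ℝ)
    (halt : ∀ v, ω v v = 0)
    (hnd : ∀ v, (∀ w, ω v w = 0) → v = 0)
    (Y : Submodule ℝ V) (hY : Module.finrank ℝ Y = 2 * n - 1)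
    (K : Submodule ℝ V) (hKY : K ≤ Y)
    (hK : Module.finrank ℝ K = n - 1)
    (hiso : ∀ u ∈ K, ∀ v ∈ K, ω u v = 0)
    (hchar : K ⊓ orth ω Y = ⊥) :
    ∃ L : Submodule ℝ V, orth ω L = L ∧ L ⊓ Y = K ∧ L ⊔ Y = ⊤ := by
  have hωalt : LinearMap.BilinForm.IsAlt ω := halt
  have hrefl : LinearMap.BilinForm.IsRefl ω := hωalt.isRefl
  have hω : LinearMap.BilinForm.Nondegenerate ω :=
    ⟨hnd, fun v hv => hnd v fun w => hrefl w v (hv w)⟩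
  have horth := orth_eq_orthogonal hrefl
  obtain ⟨v, hvK, hvY⟩ : ∃ v ∈ orth ω K, v ∉ Y := by
    by_contra! h
    have hle : orth ω Y ≤ K := by
      rw [horth, ← LinearMap.BilinForm.orthogonal_orthogonal hω hrefl K, ← horth K]
      exact LinearMap.BilinForm.orthogonal_le h
    have hdim := LinearMap.BilinForm.finrank_orthogonal hω Y
    rw [inf_eq_right.mpr hle] at hchar
    rw [← horth, hchar, finrank_bot] at hdim
    omega
  have hiso' : K ⊔ Submodule.span ℝ {v} ≤ orth ω (K ⊔ Submodule.span ℝ {v}) := by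
    intro x hx y hy
    obtain ⟨a, ha, b, hb, rfl⟩ := Submodule.mem_sup.mp hx
    obtain ⟨c, hc, d, hd, rfl⟩ := Submodule.mem_sup.mp hy
    obtain ⟨s, rfl⟩ := Submodule.mem_span_singleton.mp hb
    obtain ⟨t, rfl⟩ := Submodule.mem_span_singleton.mp hd
    simp [hiso a ha c hc, hrefl v a (hvK a ha), hvK c hc, halt v]
  have hinf : (K ⊔ Submodule.span ℝ {v}) ⊓ Y = K := by
    have hdisj : Submodule.span ℝ {v} ⊓ Y = ⊥ :=
      ((Submodule.disjoint_span_singleton_of_notMem hvY).symm).eq_bot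
    rw [sup_inf_assoc_of_le _ hKY, hdisj, sup_bot_eq]
  have hlt : Y < (K ⊔ Submodule.span ℝ {v}) ⊔ Y :=
    lt_of_le_of_ne le_sup_right fun h => hvY <| h ▸
      Submodule.mem_sup_left (Submodule.mem_sup_right (Submodule.mem_span_singleton_self v))
  have hsup : Module.finrank ℝ ((K ⊔ Submodule.span ℝ {v}) ⊔ Y : Submodule ℝ V) = 2 * n := by
    have h₁ := Submodule.finrank_lt_finrank_of_lt hlt
    have h₂ := Submodule.finrank_le ((K ⊔ Submodule.span ℝ {v}) ⊔ Y)
    omega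
  refine ⟨K ⊔ Submodule.span ℝ {v}, ?_, hinf, Submodule.eq_top_of_finrank_eq (hsup.trans hV.symm)⟩
  have hdim := Submodule.finrank_sup_add_finrank_inf_eq (K ⊔ Submodule.span ℝ {v}) Y
  rw [hinf, hsup] at hdim
  refine (Submodule.eq_of_le_of_finrank_eq hiso' ?_).symm
  rw [horth, LinearMap.BilinForm.finrank_orthogonal hω]
  omega
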